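/- Let N be a positive integer, let a be an integer with 1 ≤ a ≤ N, let r be a real number, and let m ≥ 2 be an integer. Then there exists ε > 0 such that for all real v with |v| < ε, one has Σ_{n=1}^∞ t^r_{N,a}(m, {1}^{n−1}) v^{n−1} = (1/(a^{m−1}(a−vr))) · _{m+1}F_m(1, (a+v(1−r))/N, {a/N}^{m−1}; (a+N−vr)/N, {(a+N)/N}^{m−1}; 1), where {x}^{m−1} denotes x repeated m−1 times. -/

import Mathlib

/-- All groupings of an index obtained by replacing each box in
`k₁ □ k₂ □ ⋯ □ kₙ` by a comma (new block) or a plus (merge). -/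
def groupings : List ℕ → List (List ℕ)
  | [] => [[]]
  | [x] => [[x]]
  | x :: y :: rest => ((groupings (y :: rest)).map (x :: ·)) ++ groupings ((x + y) :: rest)
termination_by l => l.length

/-- Multiple t-value of level `N` with residue `a`:
`t_{N,a}(k) = Σ_{m₁ > ⋯ > mₙ > 0, mᵢ ≡ a (mod N)} 1/(m₁^{k₁} ⋯ mₙ^{kₙ})`. -/
noncomputable def tv (N a : ℕ) (k : List ℕ) : ℝ :=
  ∑' m : {f : Fin k.length → ℕ // StrictAnti f ∧ ∀ i, 0 < f i ∧ f i % N = a % N},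
    ∏ i : Fin k.length, ((m.1 i : ℝ) ^ k.get i)⁻¹

/-- Interpolated multiple t-value of level `N`:
`t^r_{N,a}(k) = Σ_p r^{n - dep(p)} t_{N,a}(p)` over all groupings `p` of `k`. -/
noncomputable def itv (N a : ℕ) (r : ℝ) (k : List ℕ) : ℝ :=
  ((groupings k).map (fun p => r ^ (k.length - p.length) * tv N a p)).sum

/-- Rising factorial (Pochhammer symbol) `(b)ₙ = b(b+1)⋯(b+n-1)`. -/
noncomputable def poch {K : Type*} [RCLike K] (b : K) (n : ℕ) : K :=
  ∏ i ∈ Finset.range n, (b + i)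

/-- The generalized hypergeometric function
`F(b; c; z) = Σ_{n≥0} (b₁)ₙ⋯(bₚ)ₙ/((c₁)ₙ⋯(c_q)ₙ) · zⁿ/n!`. -/
noncomputable def genHyp {K : Type*} [RCLike K] (b c : List K) (z : K) : K :=
  ∑' n : ℕ, ((b.map fun x => poch x n).prod / (c.map fun x => poch x n).prod)
    * z ^ n / (n.factorial : K)

/-- Nested sum `Σ_{J > j₁ > ⋯ > jₙ ≥ 0} 1/(x_{j₁}^{k₁} ⋯ x_{jₙ}^{kₙ})`. -/
noncomputable def nestedSum (x : ℕ → ℝ) : List ℕ → ℕ → ℝ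
  | [], _ => 1
  | k :: ks, J => ∑ i ∈ Finset.range J, (x i ^ k)⁻¹ * nestedSum x ks i

/-- The part of a nested sum whose largest summation variable equals `j`. -/
noncomputable def headSum (x : ℕ → ℝ) (j : ℕ) : List ℕ → ℝ
  | [] => 0
  | k :: ks => (x j ^ k)⁻¹ * nestedSum x ks j

/-- Interpolated nested sum of `n` ones, with summation variables bounded by `j`. -/
noncomputable def interpSum (x : ℕ → ℝ) (r : ℝ) : ℕ → ℕ → ℝ
  | 0, _ => 1
  | n + 1, j => ∑ i ∈ Finset.range j, (x i)⁻¹ * interpSum x r n i +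
      r * (x j)⁻¹ * interpSum x r n j

theorem mem_groupings_cons_replicate_one (n : ℕ) : ∀ (m : ℕ) (p : List ℕ),
    p ∈ groupings (m :: List.replicate n 1) →
      ∃ k ks, p = k :: ks ∧ m ≤ k ∧ (∀ e ∈ ks, 1 ≤ e) ∧ ks.length ≤ n := by
  induction n with
  | zero =>
    intro m p hp
    simp only [List.replicate_zero, groupings, List.mem_singleton] at hp
    exact ⟨m, [], hp, le_rfl, by simp, by simp⟩
  | succ n ih =>
    intro m p hp
    simp only [List.replicate_succ, groupings, List.mem_append, List.mem_map] at hp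
    rcases hp with ⟨q, hq, rfl⟩ | hp
    · obtain ⟨k, ks, rfl, hk, hks, hl⟩ := ih 1 q hq
      refine ⟨m, k :: ks, rfl, le_rfl, ?_, by simpa using hl⟩
      intro e he
      rcases List.mem_cons.1 he with rfl | he
      · exact hk
      · exact hks e he
    · obtain ⟨k, ks, rfl, hk, hks, hl⟩ := ih (m + 1) p hp
      exact ⟨k, ks, rfl, by omega, hks, by omega⟩

theorem sum_groupings_headSum (x : ℕ → ℝ) (r : ℝ) (n : ℕ) : ∀ m j : ℕ,
    ((groupings (m :: List.replicate n 1)).map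
      (fun p => r ^ (n + 1 - p.length) * headSum x j p)).sum =
      (x j ^ m)⁻¹ * interpSum x r n j := by
  induction n with
  | zero => intro m j; simp [groupings, headSum, nestedSum, interpSum]
  | succ n ih =>
    intro m j
    rw [List.replicate_succ, groupings, List.map_append, List.sum_append, List.map_map]
    have hfirst : ((groupings (1 :: List.replicate n 1)).map
        ((fun p => r ^ (n + 1 + 1 - p.length) * headSum x j p) ∘ (m :: ·))).sum =
        (x j ^ m)⁻¹ * ∑ i ∈ Finset.range j, (x i)⁻¹ * interpSum x r n i := by
      have h1 : ∀ p ∈ groupings (1 :: List.replicate n 1),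
          ((fun p => r ^ (n + 1 + 1 - p.length) * headSum x j p) ∘ (m :: ·)) p =
          (x j ^ m)⁻¹ * ∑ i ∈ Finset.range j, r ^ (n + 1 - p.length) * headSum x i p := by
        intro p hp
        obtain ⟨k, ks, rfl, -⟩ := mem_groupings_cons_replicate_one n 1 p hp
        simp only [Function.comp_apply, List.length_cons, headSum, nestedSum,
          Nat.add_sub_add_right, ← Finset.mul_sum]
        ring
      rw [List.map_congr_left h1, List.sum_map_mul_left]
      congr 1
      rw [Finset.sum_congr rfl (fun i _ => by rw [← pow_one (x i), ← ih 1 i])]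
      induction groupings (1 :: List.replicate n 1) with
      | nil => simp
      | cons q l ihl => simp [ihl, Finset.sum_add_distrib]
    have hsecond : ((groupings ((m + 1) :: List.replicate n 1)).map
        (fun p => r ^ (n + 1 + 1 - p.length) * headSum x j p)).sum =
        r * ((x j ^ (m + 1))⁻¹ * interpSum x r n j) := by
      rw [← ih (m + 1) j, ← List.sum_map_mul_left]
      congr 1
      refine List.map_congr_left fun p hp => ?_
      obtain ⟨k, ks, rfl, -, -, hl⟩ := mem_groupings_cons_replicate_one n (m + 1) p hp
      rw [List.length_cons, show n + 1 + 1 - (ks.length + 1) = (n + 1 - (ks.length + 1)) + 1 by omega,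
        pow_succ]
      ring
    rw [hfirst, hsecond, interpSum, pow_succ, mul_inv]
    ring

theorem sum_inv_mul_sqrt_le (J : ℕ) :
    ∑ i ∈ Finset.range J, ((i : ℝ) + 1)⁻¹ * √((i : ℝ) + 1) ≤ 2 * √(J : ℝ) := by
  induction J with
  | zero => simp
  | succ J ih =>
    rw [Finset.sum_range_succ]
    refine (add_le_add_left ih _).trans ?_
    push_cast
    have hJ : (0 : ℝ) ≤ J := Nat.cast_nonneg J
    have hs := Real.sq_sqrt hJ
    have ht := Real.sq_sqrt (show (0 : ℝ) ≤ (J : ℝ) + 1 by positivity)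
    have hp : 0 < √((J : ℝ) + 1) := Real.sqrt_pos.2 (by positivity)
    have hinv : ((J : ℝ) + 1)⁻¹ * √((J : ℝ) + 1) = (√((J : ℝ) + 1))⁻¹ := by
      nth_rewrite 1 [← ht]
      field_simp
    rw [hinv, ← sub_nonneg]
    have : 2 * √((J : ℝ) + 1) - (2 * √(J : ℝ) + (√((J : ℝ) + 1))⁻¹) =
        (√((J : ℝ) + 1) - √(J : ℝ)) ^ 2 * (√((J : ℝ) + 1))⁻¹ := by
      field_simp
      nlinarith
    rw [this]
    positivity

section Growth

variable {x : ℕ → ℝ}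

theorem nestedSum_nonneg (hx : ∀ j : ℕ, (j : ℝ) + 1 ≤ x j) (ks : List ℕ) (J : ℕ) :
    0 ≤ nestedSum x ks J := by
  induction ks generalizing J with
  | nil => simp [nestedSum]
  | cons k ks ih =>
    refine Finset.sum_nonneg fun i _ => mul_nonneg ?_ (ih i)
    have : (0 : ℝ) ≤ x i := le_trans (by positivity) (hx i)
    positivity

theorem inv_pow_le_inv_pow (hx : ∀ j : ℕ, (j : ℝ) + 1 ≤ x j) {l k : ℕ} (hlk : l ≤ k) (j : ℕ) :
    (x j ^ k)⁻¹ ≤ (((j : ℝ) + 1) ^ l)⁻¹ := by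
  refine inv_anti₀ (by positivity) ?_
  have hj : (1 : ℝ) ≤ (j : ℝ) + 1 := by simp
  calc ((j : ℝ) + 1) ^ l ≤ ((j : ℝ) + 1) ^ k := pow_le_pow_right₀ hj hlk
    _ ≤ x j ^ k := pow_le_pow_left₀ (by positivity) (hx j) k

theorem nestedSum_le (hx : ∀ j : ℕ, (j : ℝ) + 1 ≤ x j) (ks : List ℕ) (hks : ∀ e ∈ ks, 1 ≤ e)
    (J : ℕ) : nestedSum x ks J ≤ 2 ^ ks.length * √((J : ℝ) + 1) := by
  induction ks generalizing J with
  | nil => simp [nestedSum]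
  | cons k ks ih =>
    have ih' := ih (fun e he => hks e (List.mem_cons_of_mem _ he))
    calc nestedSum x (k :: ks) J
        ≤ ∑ i ∈ Finset.range J, ((i : ℝ) + 1)⁻¹ * (2 ^ ks.length * √((i : ℝ) + 1)) := by
          refine Finset.sum_le_sum fun i _ => mul_le_mul ?_ (ih' i) (nestedSum_nonneg hx ks i)
            (by positivity)
          simpa using inv_pow_le_inv_pow hx (hks k List.mem_cons_self) i
      _ = 2 ^ ks.length * ∑ i ∈ Finset.range J, ((i : ℝ) + 1)⁻¹ * √((i : ℝ) + 1) := by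
          rw [Finset.mul_sum]
          exact Finset.sum_congr rfl fun i _ => by ring
      _ ≤ 2 ^ ks.length * (2 * √(J : ℝ)) := by gcongr; exact sum_inv_mul_sqrt_le J
      _ ≤ 2 ^ ks.length * (2 * √((J : ℝ) + 1)) := by gcongr; linarith
      _ = 2 ^ (k :: ks).length * √((J : ℝ) + 1) := by rw [List.length_cons, pow_succ]; ring

theorem summable_inv_sq_mul_sqrt :
    Summable fun j : ℕ => (((j : ℝ) + 1) ^ 2)⁻¹ * √((j : ℝ) + 1) := by
  have h := (summable_nat_add_iff 1).2
    (Real.summable_nat_rpow_inv.2 (show (1 : ℝ) < 3 / 2 by norm_num))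
  refine h.congr fun j => ?_
  have hj : (0 : ℝ) < (j : ℝ) + 1 := by positivity
  push_cast
  rw [Real.sqrt_eq_rpow, ← Real.rpow_natCast, ← Real.rpow_neg hj.le, ← Real.rpow_neg hj.le,
    ← Real.rpow_add hj]
  norm_num

theorem summable_headSum (hx : ∀ j : ℕ, (j : ℝ) + 1 ≤ x j) {k : ℕ} (hk : 2 ≤ k) {ks : List ℕ}
    (hks : ∀ e ∈ ks, 1 ≤ e) : Summable fun j => headSum x j (k :: ks) := by
  refine Summable.of_nonneg_of_le (fun j => ?_) (fun j => ?_)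
    (summable_inv_sq_mul_sqrt.mul_left (2 ^ ks.length))
  · have : (0 : ℝ) ≤ x j := le_trans (by positivity) (hx j)
    exact mul_nonneg (by positivity) (nestedSum_nonneg hx ks j)
  · calc headSum x j (k :: ks)
        ≤ (((j : ℝ) + 1) ^ 2)⁻¹ * (2 ^ ks.length * √((j : ℝ) + 1)) :=
          mul_le_mul (inv_pow_le_inv_pow hx hk j) (nestedSum_le hx ks hks j)
            (nestedSum_nonneg hx ks j) (by positivity)
      _ = _ := by ring

theorem HasSum.of_forall_eq {β : Type*} {f g : β → ℝ} {s : ℝ} (h : ∀ b, f b = g b)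
    (hg : HasSum g s) : HasSum f s := by
  rwa [funext h]

theorem hasSum_prod_of_nonneg {β γ : Type*} {f : β × γ → ℝ} (hf : 0 ≤ f) {g : β → ℝ} {s : ℝ}
    (hfg : ∀ b, HasSum (fun c => f (b, c)) (g b)) (hg : HasSum g s) : HasSum f s := by
  have hsum : Summable f := (summable_prod_of_nonneg hf).2
    ⟨fun b => (hfg b).summable, hg.summable.congr fun b => (hfg b).tsum_eq.symm⟩
  exact (hsum.hasSum.prod_fiberwise hfg).unique hg ▸ hsum.hasSum

theorem strictAnti_fin_cons {n : ℕ} (j : ℕ) (g : Fin n → ℕ) :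
    StrictAnti (Fin.cons j g : Fin (n + 1) → ℕ) ↔ StrictAnti g ∧ ∀ i, g i < j := by
  constructor
  · intro h
    refine ⟨fun i i' hii' => ?_, fun i => ?_⟩
    · simpa using h (Fin.succ_lt_succ_iff.2 hii')
    · simpa using h (Fin.succ_pos i)
  · rintro ⟨h, hj⟩ i
    refine Fin.cases ?_ (fun i => ?_) i
    · intro i'
      refine Fin.cases (fun h0 => absurd h0 (lt_irrefl _)) (fun i' _ => ?_) i'
      simpa using hj i'
    · intro i'
      refine Fin.cases (fun h0 => absurd h0 (by simp)) (fun i' hii' => ?_) i'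
      simpa using h (Fin.succ_lt_succ_iff.1 hii')

theorem prod_fin_cons (x : ℕ → ℝ) (k : ℕ) (ks : List ℕ) (j : ℕ) (g : Fin ks.length → ℕ) :
    ∏ i : Fin (ks.length + 1), (x ((Fin.cons j g : Fin (ks.length + 1) → ℕ) i) ^
      (k :: ks).get i)⁻¹ = (x j ^ k)⁻¹ * ∏ i, (x (g i) ^ ks.get i)⁻¹ := by
  rw [Fin.prod_univ_succ]
  rfl

open Classical in
theorem hasSum_nestedSum (hx : ∀ j : ℕ, (j : ℝ) + 1 ≤ x j) (ks : List ℕ) (J : ℕ) :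
    HasSum (fun g : Fin ks.length → ℕ =>
      if StrictAnti g ∧ ∀ i, g i < J then ∏ i, (x (g i) ^ ks.get i)⁻¹ else 0)
      (nestedSum x ks J) := by
  have hx0 : ∀ j, 0 ≤ x j := fun j => le_trans (by positivity) (hx j)
  induction ks generalizing J with
  | nil =>
    change HasSum (fun g : Fin 0 → ℕ => if StrictAnti g ∧ ∀ i, g i < J then
      ∏ i : Fin 0, (x (g i) ^ ([] : List ℕ).get i)⁻¹ else 0) (nestedSum x [] J)
    refine HasSum.of_forall_eq (fun g => ?_) (hasSum_unique fun _ : Fin 0 → ℕ => (1 : ℝ))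
    rw [if_pos ⟨fun i => i.elim0, fun i => i.elim0⟩]
    simp
  | cons k ks ih =>
    refine (Equiv.hasSum_iff (Fin.consEquiv fun _ : Fin (ks.length + 1) => ℕ)).1 ?_
    refine hasSum_prod_of_nonneg (g := fun j => if j < J then (x j ^ k)⁻¹ * nestedSum x ks j else 0)
      ?_ ?_ ?_
    · intro p
      dsimp only [Function.comp_apply, Pi.zero_apply]
      split_ifs
      · exact Finset.prod_nonneg fun i _ => inv_nonneg.2 (pow_nonneg (hx0 _) _)
      · exact le_rfl
    · intro j
      by_cases hj : j < J
      · rw [if_pos hj]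
        refine HasSum.of_forall_eq (fun g => ?_) ((ih j).mul_left (x j ^ k)⁻¹)
        have hiff : (StrictAnti (Fin.cons j g : Fin (ks.length + 1) → ℕ) ∧
            ∀ i, (Fin.cons j g : Fin (ks.length + 1) → ℕ) i < J) ↔
            StrictAnti g ∧ ∀ i, g i < j := by
          rw [strictAnti_fin_cons, Fin.forall_fin_succ]
          simp only [Fin.cons_zero, Fin.cons_succ]
          exact ⟨fun h => h.1, fun h => ⟨h, hj, fun i => (h.2 i).trans hj⟩⟩
        rw [mul_ite, mul_zero]
        refine ite_congr (propext hiff) (fun _ => ?_) fun _ => rfl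
        exact prod_fin_cons x k ks j g
      · rw [if_neg hj]
        convert hasSum_zero using 1
        funext g
        exact if_neg fun h => hj (h.2 (0 : Fin (ks.length + 1)))
    · have := hasSum_sum_of_ne_finset_zero (L := .unconditional ℕ) (f := fun j =>
        if j < J then (x j ^ k)⁻¹ * nestedSum x ks j else 0) (s := Finset.range J)
        (fun b hb => if_neg (by simpa using hb))
      rwa [Finset.sum_congr rfl (fun j hj => if_pos (Finset.mem_range.1 hj))] at this

open Classical in
theorem hasSum_headSum (hx : ∀ j : ℕ, (j : ℝ) + 1 ≤ x j) {k : ℕ} (hk : 2 ≤ k) {ks : List ℕ}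
    (hks : ∀ e ∈ ks, 1 ≤ e) :
    HasSum (fun g : Fin (k :: ks).length → ℕ =>
      if StrictAnti g then ∏ i, (x (g i) ^ (k :: ks).get i)⁻¹ else 0)
      (∑' j, headSum x j (k :: ks)) := by
  have hx0 : ∀ j, 0 ≤ x j := fun j => le_trans (by positivity) (hx j)
  refine (Equiv.hasSum_iff (Fin.consEquiv fun _ : Fin (ks.length + 1) => ℕ)).1 ?_
  refine hasSum_prod_of_nonneg ?_ (fun j => ?_) (summable_headSum hx hk hks).hasSum
  · intro p
    dsimp only [Function.comp_apply, Pi.zero_apply]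
    split_ifs
    · exact Finset.prod_nonneg fun i _ => inv_nonneg.2 (pow_nonneg (hx0 _) _)
    · exact le_rfl
  · refine HasSum.of_forall_eq (fun g => ?_) ((hasSum_nestedSum hx ks j).mul_left (x j ^ k)⁻¹)
    rw [mul_ite, mul_zero]
    refine ite_congr (propext (strictAnti_fin_cons j g)) (fun _ => ?_) fun _ => rfl
    exact prod_fin_cons x k ks j g

end Growth

theorem add_mul_div_of_mod_eq {N a y : ℕ} (hN : 1 ≤ N) (ha2 : a ≤ N) (hy : 0 < y)
    (h : y % N = a % N) : a + N * ((y - a) / N) = y := by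
  have hay : a ≤ y := by
    by_contra! hlt
    rw [Nat.mod_eq_of_lt (hlt.trans_le ha2)] at h
    rcases ha2.lt_or_eq with ha | rfl
    · rw [Nat.mod_eq_of_lt ha] at h
      omega
    · rw [Nat.mod_self] at h
      omega
  rw [Nat.mul_div_cancel' ((Nat.modEq_iff_dvd' hay).1 h.symm)]
  omega

/-- Parametrization of the summation range of a multiple t-value of level `N`
by strictly decreasing functions. -/
def residueEquiv (N a : ℕ) (hN : 1 ≤ N) (ha1 : 1 ≤ a) (ha2 : a ≤ N) (n : ℕ) :
    {g : Fin n → ℕ // StrictAnti g} ≃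
      {f : Fin n → ℕ // StrictAnti f ∧ ∀ i, 0 < f i ∧ f i % N = a % N} where
  toFun g := ⟨fun i => a + N * g.1 i,
    fun _ _ h => Nat.add_lt_add_left (Nat.mul_lt_mul_of_pos_left (g.2 h) hN) a,
    fun i => ⟨Nat.add_pos_left ha1 _, by simp⟩⟩
  invFun f := ⟨fun i => (f.1 i - a) / N, fun i j h => by
    have hi := add_mul_div_of_mod_eq hN ha2 (f.2.2 i).1 (f.2.2 i).2
    have hj := add_mul_div_of_mod_eq hN ha2 (f.2.2 j).1 (f.2.2 j).2
    have hlt := f.2.1 h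
    rw [← hi, ← hj] at hlt
    exact Nat.lt_of_mul_lt_mul_left (Nat.lt_of_add_lt_add_left hlt)⟩
  left_inv g := by
    ext i
    simp [Nat.mul_div_cancel_left _ (show 0 < N from hN)]
  right_inv f := by
    ext i
    exact add_mul_div_of_mod_eq hN ha2 (f.2.2 i).1 (f.2.2 i).2

theorem natCast_add_one_le (N a : ℕ) (hN : 1 ≤ N) (ha1 : 1 ≤ a) (j : ℕ) :
    (j : ℝ) + 1 ≤ (a : ℝ) + N * j := by
  have : j + 1 ≤ a + N * j := by nlinarith
  exact_mod_cast this

theorem tv_eq_tsum_headSum (N a : ℕ) (hN : 1 ≤ N) (ha1 : 1 ≤ a) (ha2 : a ≤ N) {k : ℕ}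
    (hk : 2 ≤ k) {ks : List ℕ} (hks : ∀ e ∈ ks, 1 ≤ e) :
    tv N a (k :: ks) = ∑' j, headSum (fun j => (a : ℝ) + N * j) j (k :: ks) := by
  classical
  have hx := natCast_add_one_le N a hN ha1
  rw [← (hasSum_headSum hx hk hks).tsum_eq, tv,
    ← (residueEquiv N a hN ha1 ha2 (k :: ks).length).tsum_eq]
  rw [← tsum_subtype_eq_of_support_subset (s := {g | StrictAnti g})]
  · refine tsum_congr fun g => ?_
    rw [if_pos g.2]
    simp [residueEquiv]
  · intro g hg
    by_contra h
    exact hg (if_neg h)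

theorem itv_eq_tsum (N a : ℕ) (hN : 1 ≤ N) (ha1 : 1 ≤ a) (ha2 : a ≤ N) (r : ℝ) {m : ℕ}
    (hm : 2 ≤ m) (n : ℕ) :
    itv N a r (m :: List.replicate n 1) =
      ∑' j : ℕ, (((a : ℝ) + N * j) ^ m)⁻¹ * interpSum (fun j => (a : ℝ) + N * j) r n j := by
  set x : ℕ → ℝ := fun j => (a : ℝ) + N * j with hxdef
  have hx : ∀ j : ℕ, (j : ℝ) + 1 ≤ x j := natCast_add_one_le N a hN ha1
  have key : ∀ l : List (List ℕ), (∀ p ∈ l, p ∈ groupings (m :: List.replicate n 1)) →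
      HasSum (fun j => (l.map (fun p => r ^ (n + 1 - p.length) * headSum x j p)).sum)
        (l.map (fun p => r ^ (n + 1 - p.length) * tv N a p)).sum := by
    intro l
    induction l with
    | nil => intro _; simp
    | cons p l ih =>
      intro hl
      obtain ⟨k, ks, rfl, hk, hks, -⟩ :=
        mem_groupings_cons_replicate_one n m p (hl p List.mem_cons_self)
      simp only [List.map_cons, List.sum_cons]
      refine HasSum.add (HasSum.mul_left _ ?_) (ih fun q hq => hl q (List.mem_cons_of_mem _ hq))
      rw [tv_eq_tsum_headSum N a hN ha1 ha2 (hm.trans hk) hks]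
      exact (summable_headSum hx (hm.trans hk) hks).hasSum
  have h := (key _ fun p hp => hp).tsum_eq
  rw [itv, List.length_cons, List.length_replicate, ← h]
  exact tsum_congr fun j => sum_groupings_headSum x r n m j

section GeneratingFunction

variable {x : ℕ → ℝ} {r v : ℝ}

theorem sum_abs_interpSum_le (hx : ∀ j : ℕ, (j : ℝ) + 1 ≤ x j) (hv : |v| * (4 + 2 * |r|) ≤ 1)
    (M j : ℕ) :
    ∑ n ∈ Finset.range M, |interpSum x r n j * v ^ n| ≤ 2 * √((j : ℝ) + 1) := by
  induction M generalizing j with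
  | zero => simp
  | succ M ih =>
    have hxinv : ∀ i, 0 ≤ (x i)⁻¹ ∧ (x i)⁻¹ ≤ ((i : ℝ) + 1)⁻¹ := fun i =>
      ⟨inv_nonneg.2 (le_trans (by positivity) (hx i)), inv_anti₀ (by positivity) (hx i)⟩
    have hstep : ∀ n, |interpSum x r (n + 1) j * v ^ (n + 1)| ≤
        |v| * (∑ i ∈ Finset.range j, ((i : ℝ) + 1)⁻¹ * |interpSum x r n i * v ^ n| +
          |r| * |interpSum x r n j * v ^ n|) := by
      intro n
      have h1 : (x j)⁻¹ ≤ 1 := (hxinv j).2.trans (inv_le_one_of_one_le₀ (by simp))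
      have heq : interpSum x r (n + 1) j * v ^ (n + 1) =
          v * (∑ i ∈ Finset.range j, (x i)⁻¹ * (interpSum x r n i * v ^ n) +
            r * ((x j)⁻¹ * (interpSum x r n j * v ^ n))) := by
        simp only [interpSum, ← mul_assoc, ← Finset.sum_mul]
        ring
      rw [heq, abs_mul]
      refine mul_le_mul_of_nonneg_left ((abs_add_le _ _).trans (add_le_add ?_ ?_)) (abs_nonneg v)
      · refine (Finset.abs_sum_le_sum_abs _ _).trans (Finset.sum_le_sum fun i _ => ?_)
        rw [abs_mul, abs_of_nonneg (hxinv i).1]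
        exact mul_le_mul_of_nonneg_right (hxinv i).2 (abs_nonneg _)
      · rw [abs_mul, abs_mul, abs_of_nonneg (hxinv j).1]
        exact mul_le_mul_of_nonneg_left (mul_le_of_le_one_left (abs_nonneg _) h1) (abs_nonneg r)
    have hone : 1 ≤ √((j : ℝ) + 1) := Real.one_le_sqrt.2 (by simp)
    have hsqrt : √(j : ℝ) ≤ √((j : ℝ) + 1) := Real.sqrt_le_sqrt (by linarith)
    rw [Finset.sum_range_succ']
    calc ∑ n ∈ Finset.range M, |interpSum x r (n + 1) j * v ^ (n + 1)| +
          |interpSum x r 0 j * v ^ 0|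
        ≤ ∑ n ∈ Finset.range M, |v| *
          (∑ i ∈ Finset.range j, ((i : ℝ) + 1)⁻¹ * |interpSum x r n i * v ^ n| +
            |r| * |interpSum x r n j * v ^ n|) + 1 :=
          add_le_add (Finset.sum_le_sum fun n _ => hstep n) (by simp [interpSum])
      _ = |v| * (∑ i ∈ Finset.range j, ((i : ℝ) + 1)⁻¹ *
            ∑ n ∈ Finset.range M, |interpSum x r n i * v ^ n| +
            |r| * ∑ n ∈ Finset.range M, |interpSum x r n j * v ^ n|) + 1 := by
          rw [← Finset.mul_sum, Finset.sum_add_distrib, Finset.sum_comm]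
          simp only [Finset.mul_sum]
      _ ≤ |v| * (∑ i ∈ Finset.range j, ((i : ℝ) + 1)⁻¹ * (2 * √((i : ℝ) + 1)) +
            |r| * (2 * √((j : ℝ) + 1))) + 1 := by
          gcongr
          · exact ih _
          · exact ih _
      _ = |v| * (2 * ∑ i ∈ Finset.range j, ((i : ℝ) + 1)⁻¹ * √((i : ℝ) + 1) +
            |r| * (2 * √((j : ℝ) + 1))) + 1 := by
          rw [Finset.mul_sum]
          simp only [mul_left_comm]
      _ ≤ |v| * (2 * (2 * √((j : ℝ) + 1)) + |r| * (2 * √((j : ℝ) + 1))) + 1 := by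
          gcongr
          exact (sum_inv_mul_sqrt_le j).trans (by linarith)
      _ = |v| * (4 + 2 * |r|) * √((j : ℝ) + 1) + 1 := by ring
      _ ≤ 1 * √((j : ℝ) + 1) + √((j : ℝ) + 1) := by gcongr
      _ = 2 * √((j : ℝ) + 1) := by ring

theorem summable_abs_interpSum (hx : ∀ j : ℕ, (j : ℝ) + 1 ≤ x j) (hv : |v| * (4 + 2 * |r|) ≤ 1)
    (j : ℕ) : Summable fun n => |interpSum x r n j * v ^ n| :=
  summable_of_sum_range_le (fun _ => abs_nonneg _) fun M => sum_abs_interpSum_le hx hv M j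

theorem summable_interpSum_prod (hx : ∀ j : ℕ, (j : ℝ) + 1 ≤ x j)
    (hv : |v| * (4 + 2 * |r|) ≤ 1) {m : ℕ} (hm : 2 ≤ m) :
    Summable fun p : ℕ × ℕ => (x p.1 ^ m)⁻¹ * (interpSum x r p.2 p.1 * v ^ p.2) := by
  have hx0 : ∀ j, 0 ≤ x j := fun j => le_trans (by positivity) (hx j)
  have habs : ∀ j n, |(x j ^ m)⁻¹ * (interpSum x r n j * v ^ n)| =
      (x j ^ m)⁻¹ * |interpSum x r n j * v ^ n| := fun j n => by
    rw [abs_mul, abs_of_nonneg (inv_nonneg.2 (pow_nonneg (hx0 j) m))]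
  refine Summable.of_abs ((summable_prod_of_nonneg fun _ => abs_nonneg _).2 ⟨fun j => ?_, ?_⟩)
  · simp only [habs]
    exact (summable_abs_interpSum hx hv j).mul_left _
  · simp only [habs, tsum_mul_left]
    refine Summable.of_nonneg_of_le (fun j => ?_) (fun j => ?_)
      (summable_inv_sq_mul_sqrt.mul_left 2)
    · exact mul_nonneg (inv_nonneg.2 (pow_nonneg (hx0 j) m)) (tsum_nonneg fun _ => abs_nonneg _)
    · calc (x j ^ m)⁻¹ * ∑' n, |interpSum x r n j * v ^ n|
          ≤ (((j : ℝ) + 1) ^ 2)⁻¹ * (2 * √((j : ℝ) + 1)) :=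
            mul_le_mul (inv_pow_le_inv_pow hx hm j)
              (Real.tsum_le_of_sum_range_le (fun _ => abs_nonneg _)
                fun M => sum_abs_interpSum_le hx hv M j)
              (tsum_nonneg fun _ => abs_nonneg _) (by positivity)
        _ = _ := by ring

theorem sub_mul_pos (hx : ∀ j : ℕ, (j : ℝ) + 1 ≤ x j) (hv : |v| * (4 + 2 * |r|) ≤ 1) (j : ℕ) :
    0 < x j - v * r := by
  have h1 := hx j
  have h2 : v * r ≤ |v| * |r| := (le_abs_self _).trans (abs_mul v r).le
  have h3 : (0 : ℝ) ≤ j := Nat.cast_nonneg j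
  nlinarith [abs_nonneg v, abs_nonneg r]

theorem tsum_interpSum (hx : ∀ j : ℕ, (j : ℝ) + 1 ≤ x j) (hv : |v| * (4 + 2 * |r|) ≤ 1) (j : ℕ) :
    ∑' n, interpSum x r n j * v ^ n =
      x j / (x j - v * r) * ∏ i ∈ Finset.range j, ((x i + v * (1 - r)) / (x i - v * r)) := by
  have hx0 : ∀ j, x j ≠ 0 := fun j => (lt_of_lt_of_le (by positivity) (hx j)).ne'
  have hd : ∀ j, x j - v * r ≠ 0 := fun j => (sub_mul_pos hx hv j).ne'
  have hs : ∀ j, Summable fun n => interpSum x r n j * v ^ n := fun j =>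
    (summable_abs_interpSum hx hv j).of_abs
  set G : ℕ → ℝ := fun j => ∑' n, interpSum x r n j * v ^ n with hG
  have hrec : ∀ j, G j = 1 + v * ∑ i ∈ Finset.range j, (x i)⁻¹ * G i + v * r * (x j)⁻¹ * G j := by
    intro j
    have heq : ∀ n, interpSum x r (n + 1) j * v ^ (n + 1) =
        v * ∑ i ∈ Finset.range j, (x i)⁻¹ * (interpSum x r n i * v ^ n) +
          v * r * (x j)⁻¹ * (interpSum x r n j * v ^ n) := by
      intro n
      simp only [interpSum, ← mul_assoc, ← Finset.sum_mul]
      ring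
    have hsum : HasSum (fun n => interpSum x r (n + 1) j * v ^ (n + 1))
        (v * ∑ i ∈ Finset.range j, (x i)⁻¹ * G i + v * r * (x j)⁻¹ * G j) := by
      simp only [heq]
      exact ((hasSum_sum fun i _ => (hs i).hasSum.mul_left _).mul_left _).add
        ((hs j).hasSum.mul_left _)
    have h0 := (hs j).tsum_eq_zero_add
    rw [hsum.tsum_eq] at h0
    simpa [hG, interpSum, add_assoc] using h0
  have hsolve : ∀ j, G j = x j / (x j - v * r) *
      (1 + v * ∑ i ∈ Finset.range j, (x i)⁻¹ * G i) := by
    intro j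
    have h := hrec j
    have h1 := hx0 j
    have h2 := hd j
    generalize 1 + v * ∑ i ∈ Finset.range j, (x i)⁻¹ * G i = U at h ⊢
    field_simp at h ⊢
    linarith
  have hprod : ∀ j, 1 + v * ∑ i ∈ Finset.range j, (x i)⁻¹ * G i =
      ∏ i ∈ Finset.range j, ((x i + v * (1 - r)) / (x i - v * r)) := by
    intro j
    induction j with
    | zero => simp
    | succ j ih =>
      rw [Finset.sum_range_succ, Finset.prod_range_succ, mul_add, ← add_assoc, hsolve j, ih]
      have h1 := hx0 j
      have h2 := hd j
      field_simp
      ring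
  rw [← hprod j]
  exact hsolve j

end GeneratingFunction

theorem genHyp_term_eq (N a : ℕ) (hN : 1 ≤ N) (ha1 : 1 ≤ a) (v r : ℝ) (m : ℕ) (hm : 2 ≤ m)
    (hd : ∀ j : ℕ, (a : ℝ) + N * j - v * r ≠ 0) (n : ℕ) :
    1 / ((a : ℝ) ^ (m - 1) * ((a : ℝ) - v * r)) *
      ((((1 : ℝ) :: ((a : ℝ) + v * (1 - r)) / N ::
          List.replicate (m - 1) ((a : ℝ) / N)).map fun y => poch y n).prod /
        (((((a : ℝ) + N - v * r) / N) ::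
          List.replicate (m - 1) (((a : ℝ) + N) / N)).map fun y => poch y n).prod *
        1 ^ n / (n.factorial : ℝ)) =
      (((a : ℝ) + N * n) ^ m)⁻¹ * (((a : ℝ) + N * n) / ((a : ℝ) + N * n - v * r) *
        ∏ i ∈ Finset.range n,
          (((a : ℝ) + N * i + v * (1 - r)) / ((a : ℝ) + N * i - v * r))) := by
  obtain ⟨l, rfl⟩ : ∃ l, m = l + 1 := ⟨m - 1, by omega⟩
  have hN0 : (N : ℝ) ≠ 0 := by positivity
  have ha0 : (a : ℝ) ≠ 0 := by positivity
  have hx : ∀ j : ℕ, (a : ℝ) + N * j ≠ 0 := fun j => by positivity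
  simp only [Nat.add_sub_cancel, List.map_cons, List.map_replicate, List.prod_cons,
    List.prod_replicate, one_pow, mul_one]
  induction n with
  | zero =>
    have := hd 0
    simp only [Nat.cast_zero, mul_zero, add_zero] at this
    simp [poch]
    field_simp
    ring
  | succ n ih =>
    have hs : ∀ y : ℝ, poch y (n + 1) = poch y n * (y + n) := fun y => Finset.prod_range_succ _ _
    have hd1 := hd n
    have hd2 := hd (n + 1)
    have hx1 := hx n
    have hx2 := hx (n + 1)
    have hn : (n : ℝ) + 1 ≠ 0 := by positivity
    push_cast at hd2 hx2
    rw [Finset.prod_range_succ, Nat.factorial_succ]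
    simp only [hs]
    have e1 : ((a : ℝ) + v * (1 - r)) / N + n = ((a : ℝ) + N * n + v * (1 - r)) / N := by
      field_simp; ring
    have e2 : ((a : ℝ) + N - v * r) / N + n = ((a : ℝ) + N * (n + 1) - v * r) / N := by
      field_simp; ring
    have e3 : (a : ℝ) / N + n = ((a : ℝ) + N * n) / N := by field_simp
    have e4 : ((a : ℝ) + N) / N + n = ((a : ℝ) + N * (n + 1)) / N := by field_simp; ring
    rw [e1, e2, e3, e4]
    push_cast
    have hfac : ((a : ℝ) + N * n + v * (1 - r)) / N * (((a : ℝ) + N * n) / N) ^ l /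
        (((a : ℝ) + N * (n + 1) - v * r) / N * (((a : ℝ) + N * (n + 1)) / N) ^ l) =
        ((a : ℝ) + N * n + v * (1 - r)) * ((a : ℝ) + N * n) ^ l /
        (((a : ℝ) + N * (n + 1) - v * r) * ((a : ℝ) + N * (n + 1)) ^ l) := by
      rw [div_pow, div_pow]
      field_simp
    calc _ = (1 / ((a : ℝ) ^ l * ((a : ℝ) - v * r)) *
          (poch 1 n * (poch (((a : ℝ) + v * (1 - r)) / N) n * poch ((a : ℝ) / N) n ^ l) /
          (poch (((a : ℝ) + N - v * r) / N) n * poch (((a : ℝ) + N) / N) n ^ l) /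
          (n.factorial : ℝ))) *
          (((a : ℝ) + N * n + v * (1 - r)) / N * (((a : ℝ) + N * n) / N) ^ l /
        (((a : ℝ) + N * (n + 1) - v * r) / N * (((a : ℝ) + N * (n + 1)) / N) ^ l)) *
          ((1 + n) / (n + 1)) := by
          rw [mul_pow, mul_pow]
          simp only [div_eq_mul_inv, mul_inv]
          ring
      _ = _ := by
          rw [ih, hfac, add_comm (1 : ℝ), div_self hn]
          field_simp
          ring

/-- For `m ≥ 2`, the generating function `Σ_{n=1}^∞ t^r_{N,a}(m, {1}^{n-1}) v^{n-1}`
is given by an `_{m+1}F_m` evaluated at `1`. -/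
theorem stmt4 (N : ℕ) (hN : 1 ≤ N) (a : ℕ) (ha1 : 1 ≤ a) (ha2 : a ≤ N) (r : ℝ)
    (m : ℕ) (hm : 2 ≤ m) :
    ∃ ε > (0 : ℝ), ∀ v : ℝ, |v| < ε →
      Summable (fun n : ℕ => itv N a r (m :: List.replicate n 1) * v ^ n) ∧
      (∑' n : ℕ, itv N a r (m :: List.replicate n 1) * v ^ n) =
        1 / ((a : ℝ) ^ (m - 1) * ((a : ℝ) - v * r)) *
          genHyp ((1 : ℝ) :: ((a : ℝ) + v * (1 - r)) / N ::
              List.replicate (m - 1) ((a : ℝ) / N))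
            ((((a : ℝ) + N - v * r) / N) ::
              List.replicate (m - 1) (((a : ℝ) + N) / N)) 1 := by
  refine ⟨(4 + 2 * |r|)⁻¹, by positivity, fun v hlt => ?_⟩
  have hv : |v| * (4 + 2 * |r|) ≤ 1 := by
    have hc : 0 < 4 + 2 * |r| := by positivity
    exact ((lt_inv_mul_iff₀' hc).1 (by simpa using hlt)).le
  set x : ℕ → ℝ := fun j => (a : ℝ) + N * j with hxdef
  have hx : ∀ j : ℕ, (j : ℝ) + 1 ≤ x j := natCast_add_one_le N a hN ha1
  have hsum := summable_interpSum_prod (x := x) hx hv hm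
  have hterm : ∀ n : ℕ, itv N a r (m :: List.replicate n 1) * v ^ n =
      ∑' j, (x j ^ m)⁻¹ * (interpSum x r n j * v ^ n) := by
    intro n
    rw [itv_eq_tsum N a hN ha1 ha2 r hm n, ← tsum_mul_right]
    exact tsum_congr fun j => mul_assoc _ _ _
  simp only [hterm]
  refine ⟨hsum.prod_symm.prod, ?_⟩
  rw [hsum.tsum_comm, genHyp, ← tsum_mul_left]
  refine tsum_congr fun j => ?_
  rw [tsum_mul_left, tsum_interpSum hx hv j]
  exact (genHyp_term_eq N a hN ha1 v r m hm (fun i => (sub_mul_pos hx hv i).ne') j).symm
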